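/- Let X be a type and A : ℕ → Set X a monotone family of subsets (A i ⊆ A j for i ≤ j) with ⋃ i, A i = X, where each subtype A i carries a topology τ_i such that for all i ≤ j the inclusion map (A i, τ_i) → (A j, τ_j) is a topological embedding. Equip X with the direct limit topology: U ⊆ X is open if and only if for every i the preimage of U under the inclusion A i → X is τ_i-open. Let B ⊆ X be a closed subset. Then for every S ⊆ B, the set S is open in the subspace topology that B inherits from X if and only if, for every i, the set {x ∈ A i : x ∈ S} is open in the subspace topology that {x ∈ A i : x ∈ B} inherits from (A i, τ_i). In other words, the direct limit topology on B determined by the pieces A i ∩ B (each with its subspace topology from (A i, τ_i)) coincides with the subspace topology that B inherits from X. -/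

import Mathlib

open Topology

/-- For a direct limit `X` of an increasing family of pieces `A i` (with compatible
topological embeddings) and a closed subset `B ⊆ X`, a subset `S ⊆ B` is open in the
subspace topology of `B` in `X` if and only if each trace `A i ∩ S` is open in the
subspace topology of `A i ∩ B` in `A i`; i.e. the direct limit topology on `B`
determined by the pieces `A i ∩ B` coincides with the subspace topology from `X`. -/
theorem direct_limit_subspace_topology_of_closed {X : Type*}
    (A : ℕ → Set X) (hmono : Monotone A)
    (hunion : ⋃ i, A i = Set.univ)
    (τ : ∀ i, TopologicalSpace (A i))
    (hembed : ∀ i j (hij : i ≤ j),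
      @Topology.IsEmbedding _ _ (τ i) (τ j) (Set.inclusion (hmono hij)))
    (tX : TopologicalSpace X)
    (hdir : ∀ U : Set X,
      IsOpen[tX] U ↔ ∀ i, IsOpen[τ i] ((Subtype.val : A i → X) ⁻¹' U))
    (B : Set X) (hB : IsClosed[tX] B) :
    ∀ S ⊆ B,
      ((∃ U : Set X, IsOpen[tX] U ∧ S = U ∩ B) ↔
        (∀ i, ∃ V : Set (A i), IsOpen[τ i] V ∧
          ((Subtype.val : A i → X) ⁻¹' S) = V ∩ ((Subtype.val : A i → X) ⁻¹' B))) := by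
  intro S hSB
  constructor
  · rintro ⟨U, hU, rfl⟩ i
    exact ⟨_, (hdir U).1 hU i, rfl⟩
  · intro h
    refine ⟨S ∪ Bᶜ, (hdir _).2 fun i ↦ ?_, ?_⟩
    · obtain ⟨V, hV, hVS⟩ := h i
      have hBc : IsOpen[τ i] ((Subtype.val : A i → X) ⁻¹' Bᶜ) :=
        (hdir _).1 hB.isOpen_compl i
      rw [Set.preimage_union, hVS, Set.preimage_compl, Set.inter_union_distrib_right,
        Set.union_compl_self, Set.inter_univ]
      exact @IsOpen.union _ _ _ (τ i) hV hBc
    · rw [Set.union_inter_distrib_right, Set.compl_inter_self, Set.union_empty,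
        Set.inter_eq_left.2 hSB]
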